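/- arXiv:1311.5667 — 2 statements merged into one kernel-verified Lean document; each statement's English description precedes it below -/
import Mathlib

section
/- Leading-order form, Case I-1 with m = 0: if m = 0 and ε = δ = 1, then lim_{Δr→0⁺} τ·⟨A⟩(Δr) = 4·Ĉ(ρ₀(r)). -/
open Filter Finset

noncomputable section

/-- Transition probability η on trits: η(0) = (β/2)(1 − Pe/2), η(1) = 1 − β,
η(2) = (β/2)(1 + Pe/2). -/
def eta (β Pe : ℝ) (ω : Fin 3) : ℝ :=
  if (ω : ℕ) = 0 then β / 2 * (1 - Pe / 2)
  else if (ω : ℕ) = 1 then 1 - β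
  else β / 2 * (1 + Pe / 2)

/-- ν(ω) = η(2 − ω). -/
def nu (β Pe : ℝ) (ω : Fin 3) : ℝ :=
  if (ω : ℕ) = 0 then β / 2 * (1 + Pe / 2)
  else if (ω : ℕ) = 1 then 1 - β
  else β / 2 * (1 - Pe / 2)

/-- Bulk local density ρ̂ⱼ(u′) = (∏ η(u_d)/ν(u_d)) · ρ₀(r + (j + Σ (1 − u_d))·Δr). -/
def rhoHat (β Pe r Δr : ℝ) (ρ₀ : ℝ → ℝ) {K : ℕ} (j : ℤ) (u : Fin K → Fin 3) : ℝ :=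
  (∏ d, eta β Pe (u d) / nu β Pe (u d)) *
    ρ₀ (r + ((j : ℝ) + ∑ d, (1 - ((u d : ℕ) : ℝ))) * Δr)

/-- F_j(ω, u) with u = u₀u′ :
F_j(ω,u) = f((η(ω)/ν(ω))·ρ̂_j(u′), (η(u₀)/ν(u₀))·ρ̂_{j+1−u₀}(u′)). -/
def Floc (β Pe r Δr : ℝ) (ρ₀ : ℝ → ℝ) (f : ℝ → ℝ → ℝ) {K : ℕ}
    (j : ℤ) (ω u₀ : Fin 3) (u' : Fin K → Fin 3) : ℝ :=
  f (eta β Pe ω / nu β Pe ω * rhoHat β Pe r Δr ρ₀ j u')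
    (eta β Pe u₀ / nu β Pe u₀ * rhoHat β Pe r Δr ρ₀ (j + 1 - ((u₀ : ℕ) : ℤ)) u')

/-- K(Δr): the sum over the trit ω and the k-digit trit string u = u₀u′. -/
def Ksum (D v β r : ℝ) (k : ℕ) (ρ₀ : ℝ → ℝ) (f : ℝ → ℝ → ℝ)
    (ε δ : ℝ) (m : ℕ) (Δr : ℝ) : ℝ :=
  Δr * ∑ ω : Fin 3, ∑ u₀ : Fin 3, ∑ u' : Fin (k - 1) → Fin 3,
    (eta β (v * Δr / D) ω + δ * nu β (v * Δr / D) ω) *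
      (nu β (v * Δr / D) u₀ * ∏ d, nu β (v * Δr / D) (u' d)) *
      (Floc β (v * Δr / D) r Δr ρ₀ f 0 ω u₀ u' +
        ε * (-1 : ℝ) ^ m * Floc β (v * Δr / D) r Δr ρ₀ f (1 - ((ω : ℕ) : ℤ)) ω u₀ u')

/-- The spatio-temporally averaged T¹-type quantity ⟨A⟩(Δr) = K/(τ·Δr),
with τ = β·Δr²/(2D). -/
def avgA (D v β r : ℝ) (k : ℕ) (ρ₀ : ℝ → ℝ) (f : ℝ → ℝ → ℝ)
    (ε δ : ℝ) (m : ℕ) (Δr : ℝ) : ℝ :=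
  Ksum D v β r k ρ₀ f ε δ m Δr / (β * Δr ^ 2 / (2 * D) * Δr)

/-- f̃(X,Y) = f(Y + X, Y − X). -/
def ftilde (f : ℝ → ℝ → ℝ) (X Y : ℝ) : ℝ := f (Y + X) (Y - X)

theorem continuous_eta (β : ℝ) (ω : Fin 3) : Continuous fun Pe => eta β Pe ω := by
  unfold eta; fin_cases ω <;> simp <;> fun_prop

theorem continuous_nu (β : ℝ) (ω : Fin 3) : Continuous fun Pe => nu β Pe ω := by
  unfold nu; fin_cases ω <;> simp <;> fun_prop

theorem nu_zero_eq_eta_zero (β : ℝ) (ω : Fin 3) : nu β 0 ω = eta β 0 ω := by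
  simp [nu, eta]

theorem eta_zero_ne_zero {β : ℝ} (hβ0 : 0 < β) (hβ1 : β < 1) (ω : Fin 3) : eta β 0 ω ≠ 0 := by
  have h : 1 - β ≠ 0 := by linarith
  fin_cases ω <;> simp [eta, hβ0.ne', h]

theorem sum_eta_zero (β : ℝ) : ∑ ω, eta β 0 ω = 1 := by
  simp [Fin.sum_univ_three, eta]; ring

/-- At vanishing grid Péclet number, the weights of the trit strings of fixed length sum to one. -/
theorem sum_prod_eta_zero (β : ℝ) (n : ℕ) : ∑ u : Fin n → Fin 3, ∏ d, eta β 0 (u d) = 1 := by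
  rw [← Fintype.piFinset_univ, ← Finset.prod_univ_sum]
  simp [sum_eta_zero]

theorem tendsto_eta (D v β : ℝ) (ω : Fin 3) :
    Tendsto (fun Δr : ℝ => eta β (v * Δr / D) ω) (nhds 0) (nhds (eta β 0 ω)) := by
  have h : Continuous fun Δr : ℝ => eta β (v * Δr / D) ω :=
    (continuous_eta β ω).comp (by fun_prop)
  simpa using h.tendsto 0

theorem tendsto_nu (D v β : ℝ) (ω : Fin 3) :
    Tendsto (fun Δr : ℝ => nu β (v * Δr / D) ω) (nhds 0) (nhds (eta β 0 ω)) := by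
  have h : Continuous fun Δr : ℝ => nu β (v * Δr / D) ω :=
    (continuous_nu β ω).comp (by fun_prop)
  simpa [nu_zero_eq_eta_zero] using h.tendsto 0

theorem tendsto_eta_div_nu {β : ℝ} (hβ0 : 0 < β) (hβ1 : β < 1) (D v : ℝ) (ω : Fin 3) :
    Tendsto (fun Δr : ℝ => eta β (v * Δr / D) ω / nu β (v * Δr / D) ω) (nhds 0) (nhds 1) := by
  have hne := eta_zero_ne_zero hβ0 hβ1 ω
  have h := (tendsto_eta D v β ω).div (tendsto_nu D v β ω) hne
  rwa [div_self hne] at h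

theorem tendsto_rhoHat {β : ℝ} {ρ₀ : ℝ → ℝ} {K : ℕ} (hβ0 : 0 < β) (hβ1 : β < 1)
    (D v r : ℝ) (hρ : Continuous ρ₀)
    (j : ℤ) (u : Fin K → Fin 3) :
    Tendsto (fun Δr : ℝ => rhoHat β (v * Δr / D) r Δr ρ₀ j u) (nhds 0) (nhds (ρ₀ r)) := by
  have hprod := tendsto_finsetProd univ
    fun d _ => tendsto_eta_div_nu hβ0 hβ1 D v (u d)
  have hval : Continuous fun Δr : ℝ =>
      ρ₀ (r + ((j : ℝ) + ∑ d, (1 - ((u d : ℕ) : ℝ))) * Δr) := by fun_prop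
  simpa [rhoHat] using hprod.mul (hval.tendsto 0)

theorem tendsto_Floc {β : ℝ} {ρ₀ : ℝ → ℝ} {K : ℕ} (hβ0 : 0 < β) (hβ1 : β < 1)
    (D v r : ℝ) (hρ : Continuous ρ₀)
    {f : ℝ → ℝ → ℝ} (hf : Continuous (Function.uncurry f))
    (j : ℤ) (ω u₀ : Fin 3) (u' : Fin K → Fin 3) :
    Tendsto (fun Δr : ℝ => Floc β (v * Δr / D) r Δr ρ₀ f j ω u₀ u') (nhds 0)
      (nhds (f (ρ₀ r) (ρ₀ r))) := by
  have hx := (tendsto_eta_div_nu hβ0 hβ1 D v ω).mul (tendsto_rhoHat hβ0 hβ1 D v r hρ j u')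
  have hy := (tendsto_eta_div_nu hβ0 hβ1 D v u₀).mul
    (tendsto_rhoHat hβ0 hβ1 D v r hρ (j + 1 - ((u₀ : ℕ) : ℤ)) u')
  rw [one_mul] at hx hy
  exact (hf.tendsto (ρ₀ r, ρ₀ r)).comp (hx.prodMk_nhds hy)

/-- Leading-order form, Case I-1 with m = 0: if m = 0 and ε = δ = 1, then
lim_{Δr→0⁺} τ·⟨A⟩(Δr) = 4·Ĉ(ρ₀(r)), with τ = β·Δr²/(2D). -/
theorem leading_form_I1_m_zero
    (D v β r : ℝ) (k : ℕ) (ρ₀ : ℝ → ℝ) (f : ℝ → ℝ → ℝ)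
    (ε δ : ℝ) (m : ℕ) (Chat : ℝ → ℝ)
    (hD : 0 < D) (hβ0 : 0 < β) (hβ1 : β < 1) (hk : 1 ≤ k)
    (hρ : ContDiff ℝ (⊤ : ℕ∞) ρ₀) (hρpos : ∀ x, 0 < ρ₀ x)
    (hf : ContDiff ℝ (⊤ : ℕ∞) (Function.uncurry f))
    (hε : ε = 1 ∨ ε = -1) (hδ : δ = 1 ∨ δ = -1)
    (hsym : ∀ x y, f y x = (-1 : ℝ) ^ m * f x y)
    (hlow : ∀ Y : ℝ, ∀ j < m, iteratedDeriv j (fun X => ftilde f X Y) 0 = 0)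
    (hchar : ∀ Y : ℝ, iteratedDeriv m (fun X => ftilde f X Y) 0 = (m.factorial : ℝ) * Chat Y)
    (hCbdd : ∃ M : ℝ, ∀ y, |Chat y| ≤ M) (hCne : ∀ y, Chat y ≠ 0)
    (hm0 : m = 0) (hε1 : ε = 1) (hδ1 : δ = 1) :
    Filter.Tendsto (fun Δr : ℝ => β * Δr ^ 2 / (2 * D) * avgA D v β r k ρ₀ f ε δ m Δr)
      (nhdsWithin 0 (Set.Ioi 0)) (nhds (4 * Chat (ρ₀ r))) := by
  subst hm0 hε1 hδ1
  have hf_diag : f (ρ₀ r) (ρ₀ r) = Chat (ρ₀ r) := by simpa [ftilde] using hchar (ρ₀ r)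
  have hterm (ω u₀ : Fin 3) (u' : Fin (k - 1) → Fin 3) :=
    (((tendsto_eta D v β ω).add ((tendsto_nu D v β ω).const_mul 1)).mul
      ((tendsto_nu D v β u₀).mul
        (tendsto_finsetProd univ fun d _ => tendsto_nu D v β (u' d)))).mul
      ((tendsto_Floc hβ0 hβ1 D v r hρ.continuous hf.continuous 0 ω u₀ u').add
        ((tendsto_Floc hβ0 hβ1 D v r hρ.continuous hf.continuous
          (1 - ((ω : ℕ) : ℤ)) ω u₀ u').const_mul (1 * (-1 : ℝ) ^ 0)))
  have hsum := tendsto_finsetSum univ fun ω _ => tendsto_finsetSum univ fun u₀ _ =>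
    tendsto_finsetSum univ fun u' _ => hterm ω u₀ u'
  have hlim : ∑ ω : Fin 3, ∑ u₀ : Fin 3, ∑ u' : Fin (k - 1) → Fin 3,
      (eta β 0 ω + 1 * eta β 0 ω) * (eta β 0 u₀ * ∏ d, eta β 0 (u' d)) *
        (f (ρ₀ r) (ρ₀ r) + 1 * (-1 : ℝ) ^ 0 * f (ρ₀ r) (ρ₀ r)) = 4 * Chat (ρ₀ r) := by
    simp only [← Finset.sum_mul, ← Finset.mul_sum, sum_prod_eta_zero, sum_eta_zero,
      Finset.sum_add_distrib, hf_diag]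
    ring
  rw [hlim] at hsum
  refine (hsum.mono_left nhdsWithin_le_nhds).congr' ?_
  filter_upwards [self_mem_nhdsWithin] with Δr hΔr
  have hΔr0 : Δr ≠ 0 := ne_of_gt hΔr
  rw [avgA, Ksum]
  field_simp
end
end

section
/- Leading-order form, Case II-1: if m = 2m'+1 is an odd positive integer (m' ≥ 0) and (ε = −1 or δ = 1), then lim_{Δr→0⁺} Δr^{1−m}·⟨A⟩(Δr) = L, where L := −(1−ε)·(v·Ĉ(ρ)/2^m)·[ (δ+1)·Σ_{p=0}^{m'} C(m,2p)·X_{1,0}^{2p}·X_{0,1}^{2(m'−p)+1}·S_ν(2p) + (δ−1)·Σ_{p=0}^{m'} C(m,2p+1)·X_{1,0}^{2p+1}·X_{0,1}^{2(m'−p)}·S_ν(2(m'−p)) ] + (δ+1)·(D/2^m)·Ĉ_ρ(ρ)·[ Σ_{p=0}^{m'} C(m,2p)·X_{1,0}^{2p}·X_{0,1}^{2(m'−p)+1}·(Y^{(1)}_{0,1} − ε·Y^{(2)}_{0,1})·S_ν(2p) + Σ_{p=0}^{m'} C(m,2p+1)·X_{1,0}^{2p+1}·X_{0,1}^{2(m'−p)}·(Y^{(1)}_{1,0}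 − ε·Y^{(2)}_{1,0})·S_ν(2(m'−p)) ] + (δ+1)·(m·D/2^m)·Ĉ(ρ)·{ Σ_{p=0}^{m'} C(2m',2p)·X_{1,0}^{2p}·X_{0,1}^{2(m'−p)}·[ X^{(1)}_{2,0}·S_ν(2(m'−p)) + X^{(1)}_{0,2}·S_ν(2p) − ε·( X^{(2)}_{2,0}·S_ν(2(m'−p)) + X^{(2)}_{0,2}·S_ν(2p) ) ] + β·Σ_{p=0}^{m'−1} C(2m',2p+1)·X_{1,0}^{2p+1}·X_{0,1}^{2(m'−p)−1}·( X^{(1)}_{1,1} − ε·X^{(2)}_{1,1} ) }. -/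
open Filter Finset

noncomputable section

set_option linter.unusedVariables false in
/-- The limit value L of Δr^(1−m)·⟨A⟩(Δr) in Case II-1 (m = 2m′+1 odd, ε = −1 or δ = 1),
expressed through the leading-order constants X_{p,q}, Y^{(i)}_{p,q}, S_ν and the
derivatives of Ĉ at ρ = ρ₀(r). -/
def LII1 (D v β r : ℝ) (ρ₀ Chat : ℝ → ℝ) (ε δ : ℝ) (m m' : ℕ) : ℝ :=
  let ρ := ρ₀ r;
  let ρr := deriv ρ₀ r;
  let ρrr := iteratedDeriv 2 ρ₀ r;
  let ρrrr := iteratedDeriv 3 ρ₀ r;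
  let X10 := v / D * ρ;
  let X01 := -(v / D) * ρ + ρr;
  let Y110 := v / D * ρ;
  let Y210 := v / D * ρ - 2 * ρr;
  let Y101 := v / D * ρ - ρr;
  let Y201 := v / D * ρ - ρr;
  let X120 := (v / D) ^ 2 * ρ;
  let X220 := (v / D) ^ 2 * ρ - 2 * (v / D) * ρr;
  let X111 := (0 : ℝ);
  let X211 := 2 * (v / D) * ρr - 2 * ρrr;
  let X102 := -(v / D) ^ 2 * ρ + 2 * (v / D) * ρr - ρrr;
  let X202 := -(v / D) ^ 2 * ρ + 2 * (v / D) * ρr - ρrr;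
  let Y120 := (v / D) ^ 2 * ρ;
  let Y220 := (v / D) ^ 2 * ρ - 2 * (v / D) * ρr + 2 * ρrr;
  let Y111 := (0 : ℝ);
  let Y211 := -(2 * (v / D) * ρr) + 2 * ρrr;
  let Y102 := (v / D) ^ 2 * ρ - 2 * (v / D) * ρr + ρrr;
  let Y202 := (v / D) ^ 2 * ρ - 2 * (v / D) * ρr + ρrr;
  let X130 := (v / D) ^ 3 * ρ;
  let X230 := (v / D) ^ 3 * ρ - 2 * (v / D) ^ 2 * ρr + 2 * (v / D) * ρrr;
  let X121 := (0 : ℝ);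
  let X221 := -(2 * (v / D) * ρrr) + 2 * ρrrr;
  let X112 := (0 : ℝ);
  let X212 := 2 * (v / D) ^ 2 * ρr - 4 * (v / D) * ρrr + 2 * ρrrr;
  let X103 := -(v / D) ^ 3 * ρ + 2 * (v / D) ^ 2 * ρr - 2 * (v / D) * ρrr + 2 / 3 * ρrrr;
  let X203 := -(v / D) ^ 3 * ρ + 2 * (v / D) ^ 2 * ρr - 2 * (v / D) * ρrr + 2 / 3 * ρrrr;
  let Snu : ℕ → ℝ := fun a => if a = 0 then (1 : ℝ) else β;
  let Cd := deriv Chat ρ;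
  let Cdd := iteratedDeriv 2 Chat ρ;
  -(1 - ε) * (v * Chat ρ / 2 ^ m) *
      ((δ + 1) * (∑ p ∈ Finset.range (m' + 1),
          ((m.choose (2 * p) : ℝ) * X10 ^ (2 * p) * X01 ^ (2 * (m' - p) + 1) * Snu (2 * p)))
        + (δ - 1) * (∑ p ∈ Finset.range (m' + 1),
          ((m.choose (2 * p + 1) : ℝ) * X10 ^ (2 * p + 1) * X01 ^ (2 * (m' - p)) *
            Snu (2 * (m' - p)))))
    + (δ + 1) * (D / 2 ^ m) * Cd *
      ((∑ p ∈ Finset.range (m' + 1),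
          ((m.choose (2 * p) : ℝ) * X10 ^ (2 * p) * X01 ^ (2 * (m' - p) + 1) *
            (Y101 - ε * Y201) * Snu (2 * p)))
        + (∑ p ∈ Finset.range (m' + 1),
          ((m.choose (2 * p + 1) : ℝ) * X10 ^ (2 * p + 1) * X01 ^ (2 * (m' - p)) *
            (Y110 - ε * Y210) * Snu (2 * (m' - p)))))
    + (δ + 1) * ((m : ℝ) * D / 2 ^ m) * Chat ρ *
      ((∑ p ∈ Finset.range (m' + 1),
          (((2 * m').choose (2 * p) : ℝ) * X10 ^ (2 * p) * X01 ^ (2 * (m' - p)) *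
            (X120 * Snu (2 * (m' - p)) + X102 * Snu (2 * p) -
              ε * (X220 * Snu (2 * (m' - p)) + X202 * Snu (2 * p)))))
        + β * (∑ p ∈ Finset.range m',
          (((2 * m').choose (2 * p + 1) : ℝ) * X10 ^ (2 * p + 1) * X01 ^ (2 * (m' - p) - 1) *
            (X111 - ε * X211))))

section

open Asymptotics Topology

theorem ContDiff.iteratedDeriv_fst {F : ℝ × ℝ → ℝ} (hF : ContDiff ℝ (⊤ : ℕ∞) F) (n : ℕ) :
    ContDiff ℝ (⊤ : ℕ∞) (fun p : ℝ × ℝ => iteratedDeriv n (fun x => F (x, p.2)) p.1) := by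
  induction n with
  | zero => simpa using hF
  | succ n ih =>
    set G : ℝ × ℝ → ℝ := fun p => iteratedDeriv n (fun x => F (x, p.2)) p.1 with hG
    have key : (fun p : ℝ × ℝ => iteratedDeriv (n + 1) (fun x => F (x, p.2)) p.1)
        = fun p => fderiv ℝ G p (1, 0) := by
      funext p
      rw [iteratedDeriv_succ]
      have hd : HasFDerivAt G (fderiv ℝ G p) (p.1, p.2) :=
        (ih.differentiable (by simp) p).hasFDerivAt
      have hl : HasDerivAt (fun x : ℝ => (x, p.2)) ((1 : ℝ), (0 : ℝ)) p.1 :=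
        (hasDerivAt_id p.1).prodMk (hasDerivAt_const p.1 p.2)
      exact (hd.comp_hasDerivAt p.1 hl).deriv
    rw [key]
    exact (ih.fderiv_right (m := (⊤ : ℕ∞)) (by simp)).clm_apply contDiff_const

theorem exists_eq_pow_add_pow_succ_of_iteratedDeriv_eq_zero {g : ℝ → ℝ}
    (hg : ContDiff ℝ (⊤ : ℕ∞) g) {m : ℕ} (h0 : ∀ j < m, iteratedDeriv j g 0 = 0) (x : ℝ) :
    ∃ ξ : ℝ, |ξ| ≤ |x| ∧ g x = iteratedDeriv m g 0 / (m.factorial : ℝ) * x ^ m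
      + iteratedDeriv (m + 1) g ξ / ((m + 1).factorial : ℝ) * x ^ (m + 1) := by
  have hsum : ∀ y : ℝ, ∑ j ∈ range (m + 1), ((j.factorial : ℝ)⁻¹ * y ^ j) * iteratedDeriv j g 0
      = iteratedDeriv m g 0 / (m.factorial : ℝ) * y ^ m := by
    intro y
    rw [sum_range_succ, sum_eq_zero fun j hj => by rw [h0 j (mem_range.1 hj), mul_zero]]
    ring
  rcases eq_or_ne (0 : ℝ) x with rfl | hx
  · refine ⟨0, le_rfl, ?_⟩
    rcases Nat.eq_zero_or_pos m with rfl | hm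
    · simp
    · simpa [hm.ne'] using h0 0 hm
  · obtain ⟨ξ, hξ, h⟩ := taylor_mean_remainder_lagrange_iteratedDeriv (n := m) hx
      ((hg.of_le (by exact_mod_cast le_top)).contDiffOn)
    refine ⟨ξ, ?_, ?_⟩
    · rcases lt_or_gt_of_ne hx with hx | hx
      · rw [Set.uIoo_of_lt hx] at hξ
        rw [abs_of_pos hξ.1, abs_of_pos hx]; exact hξ.2.le
      · rw [Set.uIoo_of_gt hx] at hξ
        rw [abs_of_neg hξ.2, abs_of_neg hx]; linarith [hξ.1]
    · rw [taylor_within_apply] at h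
      have : ∀ j ∈ range (m + 1), ((j.factorial : ℝ)⁻¹ * (x - 0) ^ j) •
          iteratedDerivWithin j g (Set.uIcc 0 x) 0
          = ((j.factorial : ℝ)⁻¹ * x ^ j) * iteratedDeriv j g 0 := by
        intro j _
        rw [iteratedDerivWithin_eq_iteratedDeriv (uniqueDiffOn_uIcc hx)
          (hg.of_le (by exact_mod_cast le_top)).contDiffAt Set.left_mem_uIcc, sub_zero, smul_eq_mul]
      rw [sum_congr rfl this, hsum, sub_zero] at h
      linear_combination h

theorem iteratedDeriv_zero_of_odd_of_even {g : ℝ → ℝ} (hg : ∀ x, g (-x) = -g x) {n : ℕ}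
    (hn : Even n) : iteratedDeriv n g 0 = 0 := by
  have h := iteratedDeriv_comp_neg n g 0
  have h2 : (fun x => g (-x)) = -g := by funext x; simp [hg]
  rw [h2, iteratedDeriv_neg, hn.neg_one_pow, neg_zero, one_smul] at h
  linarith

/-- A function that is odd and flat to odd order `m` in its first variable equals its leading term
up to `o(x ^ (m + 1))`, locally uniformly in the second variable. -/
theorem isLittleO_sub_leading_term {F : ℝ × ℝ → ℝ} (hF : ContDiff ℝ (⊤ : ℕ∞) F) {m : ℕ}
    (hm : Odd m) (hodd : ∀ x y, F (-x, y) = -F (x, y))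
    (h0 : ∀ y, ∀ j < m, iteratedDeriv j (fun x => F (x, y)) 0 = 0) {C : ℝ → ℝ}
    (hC : ∀ y, iteratedDeriv m (fun x => F (x, y)) 0 = (m.factorial : ℝ) * C y) (y₀ : ℝ) :
    (fun p : ℝ × ℝ => F p - C p.2 * p.1 ^ m) =o[𝓝 (0, y₀)] fun p => p.1 ^ (m + 1) := by
  rw [isLittleO_iff]
  intro c hc
  have hcont := (hF.iteratedDeriv_fst (m + 1)).continuous.tendsto (0, y₀)
  simp only [iteratedDeriv_zero_of_odd_of_even (g := fun x => F (x, y₀)) (fun x => hodd x y₀)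
    hm.add_one] at hcont
  obtain ⟨d, hd, hball⟩ := Metric.tendsto_nhds_nhds.1 hcont c hc
  filter_upwards [Metric.ball_mem_nhds _ hd] with p hp
  have hs : ContDiff ℝ (⊤ : ℕ∞) fun x => F (x, p.2) := hF.comp (contDiff_id.prodMk contDiff_const)
  obtain ⟨ξ, hξ, h⟩ := exists_eq_pow_add_pow_succ_of_iteratedDeriv_eq_zero hs (h0 p.2) p.1
  rw [hC, mul_div_cancel_left₀ _ (by positivity)] at h
  have h1 : dist ((ξ, p.2) : ℝ × ℝ) (0, y₀) < d := by
    rw [Metric.mem_ball, Prod.dist_eq, max_lt_iff] at hp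
    rw [Prod.dist_eq, max_lt_iff]
    refine ⟨lt_of_le_of_lt ?_ hp.1, hp.2⟩
    simpa [Real.dist_eq] using hξ
  have h2 := hball h1
  rw [Real.dist_eq, sub_zero] at h2
  have h3 : F p - C p.2 * p.1 ^ m
      = iteratedDeriv (m + 1) (fun x => F (x, p.2)) ξ / ((m + 1).factorial : ℝ) * p.1 ^ (m + 1) := by
    linear_combination h
  rw [h3, norm_mul]
  gcongr
  rw [Real.norm_eq_abs, abs_div, Nat.abs_cast]
  exact (div_le_self (abs_nonneg _) (by exact_mod_cast Nat.succ_le_of_lt (Nat.factorial_pos _))).trans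
    h2.le

theorem hasDerivAt_dslope_self {g : ℝ → ℝ} (hg : ContDiff ℝ 2 g) (a : ℝ) :
    HasDerivAt (dslope g a) (iteratedDeriv 2 g a / 2) a := by
  rw [hasDerivAt_iff_isLittleO]
  have h := taylor_isLittleO_univ (x₀ := a) hg
  rw [isLittleO_iff] at h ⊢
  intro c hc
  filter_upwards [h hc] with x hx
  rcases eq_or_ne x a with rfl | hxa
  · simp
  · have hx0 : x - a ≠ 0 := sub_ne_zero.2 hxa
    have e : g x - taylorWithinEval g 2 Set.univ a x
        = (x - a) * (dslope g a x - dslope g a a - (x - a) • (iteratedDeriv 2 g a / 2)) := by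
      rw [taylor_within_apply, dslope_of_ne _ hxa, slope_def_field, dslope_same]
      simp only [sum_range_succ, range_zero, sum_empty, iteratedDerivWithin_univ]
      simp [iteratedDeriv_one]
      field_simp
      ring
    rw [e, norm_mul, norm_pow, pow_two] at hx
    have : 0 < ‖x - a‖ := norm_pos_iff.2 hx0
    exact le_of_mul_le_mul_left (by linarith) this

/-- `φ h = h ^ m * (A + B * h + o(h))` as `h → 0`. -/
def HasExpansion (m : ℕ) (φ : ℝ → ℝ) (A B : ℝ) : Prop :=
  ∃ G : ℝ → ℝ, G 0 = A ∧ HasDerivAt G B 0 ∧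
    (fun h => φ h - h ^ m * G h) =o[𝓝 0] fun h => h ^ (m + 1)

namespace HasExpansion

variable {m : ℕ} {φ ψ : ℝ → ℝ} {A B A' B' : ℝ}

theorem add (hφ : HasExpansion m φ A B) (hψ : HasExpansion m ψ A' B') :
    HasExpansion m (fun h => φ h + ψ h) (A + A') (B + B') := by
  obtain ⟨G, hG0, hG, hGo⟩ := hφ
  obtain ⟨G', hG0', hG', hGo'⟩ := hψ
  refine ⟨fun h => G h + G' h, by simp [hG0, hG0'], hG.add hG', ?_⟩
  exact (hGo.add hGo').congr_left fun h => by ring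

theorem mul_left {w : ℝ → ℝ} {w' : ℝ} (hw : HasDerivAt w w' 0) (hφ : HasExpansion m φ A B) :
    HasExpansion m (fun h => w h * φ h) (w 0 * A) (w' * A + w 0 * B) := by
  obtain ⟨G, rfl, hG, hGo⟩ := hφ
  refine ⟨fun h => w h * G h, rfl, hw.mul hG, ?_⟩
  have hw1 : w =O[𝓝 0] fun _ => (1 : ℝ) := hw.continuousAt.isBigO_one ℝ
  exact (hw1.mul_isLittleO hGo).congr (fun h => by ring) fun h => by ring

theorem const_mul (c : ℝ) (hφ : HasExpansion m φ A B) :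
    HasExpansion m (fun h => c * φ h) (c * A) (c * B) := by
  simpa using hφ.mul_left (hasDerivAt_const 0 c)

theorem sum {ι : Type*} {s : Finset ι} {φ : ι → ℝ → ℝ} {A B : ι → ℝ}
    (h : ∀ i ∈ s, HasExpansion m (φ i) (A i) (B i)) :
    HasExpansion m (fun x => ∑ i ∈ s, φ i x) (∑ i ∈ s, A i) (∑ i ∈ s, B i) := by
  classical
  induction s using Finset.induction_on with
  | empty => exact ⟨fun _ => 0, by simp, by simpa using hasDerivAt_const 0 (0 : ℝ), by simp⟩
  | insert i s hi ih =>
    simp only [sum_insert hi]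
    exact (h i (mem_insert_self i s)).add (ih fun j hj => h j (mem_insert_of_mem hj))

theorem tendsto_div_pow (hφ : HasExpansion m φ 0 B) :
    Tendsto (fun h => φ h / h ^ (m + 1)) (𝓝[>] 0) (𝓝 B) := by
  obtain ⟨G, hG0, hG, hGo⟩ := hφ
  have h1 : Tendsto (fun h => h⁻¹ * G h) (𝓝[>] 0) (𝓝 B) := by
    have := hG.tendsto_slope_zero_right
    simpa [hG0] using this
  have h2 := hGo.tendsto_div_nhds_zero.mono_left (nhdsWithin_le_nhds (s := Set.Ioi 0))
  have h3 := h2.add h1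
  rw [zero_add] at h3
  refine h3.congr' ?_
  filter_upwards [self_mem_nhdsWithin] with h hh
  have : h ≠ 0 := ne_of_gt hh
  field_simp
  ring

theorem comp_leading_term {F : ℝ × ℝ → ℝ} {C : ℝ → ℝ} {X Y Z : ℝ → ℝ} {y₀ z₀ C' Y' Z' : ℝ}
    (hF : (fun p : ℝ × ℝ => F p - C p.2 * p.1 ^ m) =o[𝓝 (0, y₀)] fun p => p.1 ^ (m + 1))
    (hX : ∀ᶠ h in 𝓝 0, X h = h * Z h) (hZ0 : Z 0 = z₀) (hY0 : Y 0 = y₀)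
    (hZ : HasDerivAt Z Z' 0) (hY : HasDerivAt Y Y' 0) (hC : HasDerivAt C C' y₀) :
    HasExpansion m (fun h => F (X h, Y h)) (C y₀ * z₀ ^ m)
      (C' * Y' * z₀ ^ m + C y₀ * (m * z₀ ^ (m - 1) * Z')) := by
  subst hY0 hZ0
  refine ⟨fun h => C (Y h) * Z h ^ m, rfl, (hC.comp 0 hY).mul (hZ.pow m), ?_⟩
  have hZc := hZ.continuousAt
  have ht : Tendsto (fun h => (h * Z h, Y h)) (𝓝 0) (𝓝 (0, Y 0)) := by
    refine Tendsto.prodMk_nhds ?_ hY.continuousAt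
    simpa using (continuousAt_id (x := (0 : ℝ))).tendsto.mul hZc.tendsto
  have h1 := hF.comp_tendsto ht
  have h2 : (fun h => (h * Z h) ^ (m + 1)) =O[𝓝 0] fun h : ℝ => h ^ (m + 1) := by
    have hb : (fun h => Z h ^ (m + 1)) =O[𝓝 0] fun _ => (1 : ℝ) :=
      (hZc.pow (m + 1)).isBigO_one ℝ
    exact ((isBigO_refl (fun h : ℝ => h ^ (m + 1)) (𝓝 0)).mul hb).congr
      (fun h => by ring) fun h => by ring
  refine (h1.trans_isBigO h2).congr' ?_ EventuallyEq.rfl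
  filter_upwards [hX] with h hh
  simp only [Function.comp, hh]
  ring

end HasExpansion

theorem Finset.sum_range_two_mul {M : Type*} [AddCommMonoid M] (g : ℕ → M) (n : ℕ) :
    ∑ i ∈ range (2 * n), g i = ∑ p ∈ range n, (g (2 * p) + g (2 * p + 1)) := by
  induction n with
  | zero => simp
  | succ n ih => rw [mul_add, sum_range_succ, sum_range_succ, ih, sum_range_succ, add_assoc]

theorem add_pow_two_mul_add_one (A B : ℝ) (n : ℕ) :
    (A + B) ^ (2 * n + 1)
      = ∑ p ∈ range (n + 1),
          ((2 * n + 1).choose (2 * p) : ℝ) * A ^ (2 * p) * B ^ (2 * (n - p) + 1)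
        + ∑ p ∈ range (n + 1),
          ((2 * n + 1).choose (2 * p + 1) : ℝ) * A ^ (2 * p + 1) * B ^ (2 * (n - p)) := by
  rw [add_pow, show 2 * n + 1 + 1 = 2 * (n + 1) by ring, sum_range_two_mul, ← sum_add_distrib]
  refine sum_congr rfl fun p hp => ?_
  have hp : p ≤ n := Nat.lt_succ_iff.1 (mem_range.1 hp)
  rw [show 2 * n + 1 - 2 * p = 2 * (n - p) + 1 by omega,
    show 2 * n + 1 - (2 * p + 1) = 2 * (n - p) by omega]
  ring

theorem add_pow_two_mul (A B : ℝ) (n : ℕ) :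
    (A + B) ^ (2 * n)
      = ∑ p ∈ range (n + 1), ((2 * n).choose (2 * p) : ℝ) * A ^ (2 * p) * B ^ (2 * (n - p))
        + ∑ p ∈ range n,
          ((2 * n).choose (2 * p + 1) : ℝ) * A ^ (2 * p + 1) * B ^ (2 * (n - p) - 1) := by
  rw [add_pow, sum_range_succ, sum_range_two_mul, sum_range_succ, add_right_comm,
    ← sum_add_distrib]
  congr 1
  · refine sum_congr rfl fun p hp => ?_
    have hp : p < n := mem_range.1 hp
    rw [show 2 * n - 2 * p = 2 * (n - p) by omega,
      show 2 * n - (2 * p + 1) = 2 * (n - p) - 1 by omega]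
    ring
  · simp

theorem sum_choose_even_of_odd (A B : ℝ) (n : ℕ) :
    ∑ p ∈ range (n + 1), ((2 * n + 1).choose (2 * p) : ℝ) * A ^ (2 * p) * B ^ (2 * (n - p) + 1)
      = ((A + B) ^ (2 * n + 1) - (A - B) ^ (2 * n + 1)) / 2 := by
  have h1 := add_pow_two_mul_add_one A B n
  have h2 := add_pow_two_mul_add_one A (-B) n
  simp only [(odd_two_mul_add_one _).neg_pow, (even_two_mul _).neg_pow, mul_neg,
    sum_neg_distrib, ← sub_eq_add_neg] at h2
  linarith

theorem sum_choose_odd_of_odd (A B : ℝ) (n : ℕ) :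
    ∑ p ∈ range (n + 1), ((2 * n + 1).choose (2 * p + 1) : ℝ) * A ^ (2 * p + 1) * B ^ (2 * (n - p))
      = ((A + B) ^ (2 * n + 1) + (A - B) ^ (2 * n + 1)) / 2 := by
  have h1 := add_pow_two_mul_add_one A B n
  have h2 := sum_choose_even_of_odd A B n
  linarith

theorem sum_choose_even_of_even (A B : ℝ) (n : ℕ) :
    ∑ p ∈ range (n + 1), ((2 * n).choose (2 * p) : ℝ) * A ^ (2 * p) * B ^ (2 * (n - p))
      = ((A + B) ^ (2 * n) + (A - B) ^ (2 * n)) / 2 := by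
  have h1 := add_pow_two_mul A B n
  have h2 := add_pow_two_mul A (-B) n
  have h3 : ∀ p ∈ range n,
      ((2 * n).choose (2 * p + 1) : ℝ) * A ^ (2 * p + 1) * (-B) ^ (2 * (n - p) - 1)
      = -(((2 * n).choose (2 * p + 1) : ℝ) * A ^ (2 * p + 1) * B ^ (2 * (n - p) - 1)) := by
    intro p hp
    have hp : p < n := mem_range.1 hp
    have ho : Odd (2 * (n - p) - 1) := ⟨n - p - 1, by omega⟩
    rw [ho.neg_pow, mul_neg]
  rw [sum_congr rfl h3] at h2
  simp only [(even_two_mul _).neg_pow, sum_neg_distrib, ← sub_eq_add_neg] at h2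
  linarith

theorem sum_choose_odd_of_even (A B : ℝ) (n : ℕ) :
    ∑ p ∈ range n, ((2 * n).choose (2 * p + 1) : ℝ) * A ^ (2 * p + 1) * B ^ (2 * (n - p) - 1)
      = ((A + B) ^ (2 * n) - (A - B) ^ (2 * n)) / 2 := by
  have h1 := add_pow_two_mul A B n
  have h2 := sum_choose_even_of_even A B n
  linarith

theorem sum_mul_ite_zero_left (c : ℕ → ℝ) (β : ℝ) (n : ℕ) :
    ∑ p ∈ range (n + 1), c p * (if 2 * p = 0 then 1 else β)
      = β * ∑ p ∈ range (n + 1), c p + (1 - β) * c 0 := by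
  rw [sum_range_succ', sum_range_succ', mul_add, mul_sum]
  simp only [mul_eq_zero, Nat.add_eq_zero_iff, one_ne_zero, and_false, or_false, if_false,
    OfNat.ofNat_ne_zero, if_true, mul_zero, mul_comm (c _)]
  ring

theorem sum_mul_ite_zero_right (c : ℕ → ℝ) (β : ℝ) (n : ℕ) :
    ∑ p ∈ range (n + 1), c p * (if 2 * (n - p) = 0 then 1 else β)
      = β * ∑ p ∈ range (n + 1), c p + (1 - β) * c n := by
  have h : ∀ p ∈ range n, c p * (if 2 * (n - p) = 0 then 1 else β) = β * c p := by
    intro p hp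
    have hp : p < n := mem_range.1 hp
    rw [if_neg (by omega), mul_comm]
  rw [sum_range_succ, sum_range_succ, sum_congr rfl h, mul_add, mul_sum]
  simp
  ring

/-- The signed step `ω - 1 ∈ {-1, 0, 1}` of a trit. -/
def tritSign (ω : Fin 3) : ℝ := ((ω : ℕ) : ℝ) - 1

/-- The driftless transition probability. -/
def tritWeight (β : ℝ) (ω : Fin 3) : ℝ := if (ω : ℕ) = 1 then 1 - β else β / 2

theorem eta_eq (β Pe : ℝ) (ω : Fin 3) :
    eta β Pe ω = tritWeight β ω * (1 + tritSign ω * Pe / 2) := by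
  fin_cases ω <;> simp [eta, tritWeight, tritSign, -mul_eq_mul_left_iff] <;> ring

theorem nu_eq (β Pe : ℝ) (ω : Fin 3) :
    nu β Pe ω = tritWeight β ω * (1 - tritSign ω * Pe / 2) := by
  fin_cases ω <;> simp [nu, tritWeight, tritSign, -mul_eq_mul_left_iff] <;> ring

theorem tritWeight_pos {β : ℝ} (hβ0 : 0 < β) (hβ1 : β < 1) (ω : Fin 3) : 0 < tritWeight β ω := by
  unfold tritWeight
  split_ifs <;> linarith

theorem sum_tritWeight (β : ℝ) : ∑ ω, tritWeight β ω = 1 := by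
  simp [Fin.sum_univ_three, tritWeight]
  ring

/-- The increment quotient `(η / ν - 1) / Δr` of the ratio of transition probabilities, in terms
of the step `s = ω - 1` and `a = v / D`. -/
def ratioSlope (a s h : ℝ) : ℝ := s * a / (1 - s * (a * h) / 2)

theorem hasDerivAt_ratioSlope (a s : ℝ) :
    HasDerivAt (ratioSlope a s) (s ^ 2 * a ^ 2 / 2) 0 := by
  have h1 : HasDerivAt (fun h : ℝ => 1 - s * (a * h) / 2) (-(s * (a * 1) / 2)) 0 :=
    ((((hasDerivAt_id (0 : ℝ)).const_mul a).const_mul s).div_const 2).const_sub 1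
  have h2 := (hasDerivAt_const (0 : ℝ) (s * a)).div h1 (by simp)
  convert! h2 using 1
  simp
  ring

theorem eta_div_nu_eq {β a h : ℝ} (hβ0 : 0 < β) (hβ1 : β < 1) {ω : Fin 3}
    (hs : 1 - tritSign ω * (a * h) / 2 ≠ 0) :
    eta β (a * h) ω / nu β (a * h) ω = 1 + h * ratioSlope a (tritSign ω) h := by
  have hw := (tritWeight_pos hβ0 hβ1 ω).ne'
  rw [eta_eq, nu_eq, ratioSlope, mul_div_mul_left _ _ hw, div_eq_iff hs, add_mul, mul_assoc h,
    div_mul_cancel₀ _ hs]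
  ring

theorem hasDerivAt_nu (β a : ℝ) (ω : Fin 3) :
    HasDerivAt (fun h => nu β (a * h) ω) (-(tritWeight β ω * (tritSign ω * a / 2))) 0 := by
  simp only [nu_eq]
  have h1 := (((((hasDerivAt_id (0 : ℝ)).const_mul a).const_mul (tritSign ω)).div_const
    2).const_sub 1).const_mul (tritWeight β ω)
  convert! h1 using 1
  ring

theorem hasDerivAt_eta (β a : ℝ) (ω : Fin 3) :
    HasDerivAt (fun h => eta β (a * h) ω) (tritWeight β ω * (tritSign ω * a / 2)) 0 := by
  simp only [eta_eq]
  have h1 := (((((hasDerivAt_id (0 : ℝ)).const_mul a).const_mul (tritSign ω)).div_const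
    2).const_add 1).const_mul (tritWeight β ω)
  convert! h1 using 1
  ring

theorem nu_zero (β : ℝ) (ω : Fin 3) : nu β 0 ω = tritWeight β ω := by simp [nu_eq]

theorem eta_zero (β : ℝ) (ω : Fin 3) : eta β 0 ω = tritWeight β ω := by simp [eta_eq]

theorem differentiableAt_prod_nu (β a : ℝ) {K : ℕ} (u : Fin K → Fin 3) :
    DifferentiableAt ℝ (fun h => ∏ d, nu β (a * h) (u d)) 0 :=
  DifferentiableAt.fun_finsetProd fun d _ => (hasDerivAt_nu β a (u d)).differentiableAt

theorem differentiableAt_prod_eta_div_nu {β : ℝ} (hβ0 : 0 < β) (hβ1 : β < 1) (a : ℝ) {K : ℕ}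
    (u : Fin K → Fin 3) :
    DifferentiableAt ℝ (fun h => ∏ d, eta β (a * h) (u d) / nu β (a * h) (u d)) 0 :=
  DifferentiableAt.fun_finsetProd fun d _ =>
    (hasDerivAt_eta β a (u d)).differentiableAt.fun_div (hasDerivAt_nu β a (u d)).differentiableAt
      (by simpa [nu_zero] using (tritWeight_pos hβ0 hβ1 _).ne')

/-- The second coefficient of the expansion of `Floc` in the spacing, where `z` is the leading
coefficient of half the difference of its two densities. -/
def flocSlope (m : ℕ) (a ρ ρr ρrr C C' s t c P' z : ℝ) : ℝ :=
  C' * (P' * ρ + (s * a * ρ + t * a * ρ + (2 * c - t) * ρr) / 2) * z ^ m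
    + C * (m * z ^ (m - 1) * (P' * z
      + (s ^ 2 * a ^ 2 / 2 * ρ + s * a * c * ρr + c ^ 2 * ρrr / 2
        - (t ^ 2 * a ^ 2 / 2 * ρ + t * a * (c - t) * ρr + (c - t) ^ 2 * ρrr / 2)) / 2))

/-- Expansion of `Floc` at spacing `h → 0`. Here `s`, `t` are the steps of the two leading trits,
`c` is the displacement, and `P'` the derivative of the prefactor of the local density. -/
theorem hasExpansion_Floc {a β r : ℝ} {ρ₀ : ℝ → ℝ} {f : ℝ → ℝ → ℝ} {m K : ℕ} {C : ℝ → ℝ} {C' : ℝ}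
    (hβ0 : 0 < β) (hβ1 : β < 1) (hρ : ContDiff ℝ (⊤ : ℕ∞) ρ₀)
    (hF : (fun p : ℝ × ℝ => ftilde f p.1 p.2 - C p.2 * p.1 ^ m)
      =o[𝓝 (0, ρ₀ r)] fun p => p.1 ^ (m + 1))
    (hC : HasDerivAt C C' (ρ₀ r)) (j : ℤ) (ω u₀ : Fin 3) (u : Fin K → Fin 3)
    {s t c P' z : ℝ} (hs : s = tritSign ω) (ht : t = tritSign u₀)
    (hc : c = (j : ℝ) + ∑ d, (1 - ((u d : ℕ) : ℝ)))
    (hP' : P' = deriv (fun h => ∏ d, eta β (a * h) (u d) / nu β (a * h) (u d)) 0)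
    (hz : z = (s * (a * ρ₀ r) + t * (-a * ρ₀ r + deriv ρ₀ r)) / 2) :
    HasExpansion m (fun h => Floc β (a * h) r h ρ₀ f j ω u₀ u) (C (ρ₀ r) * z ^ m)
      (flocSlope m a (ρ₀ r) (deriv ρ₀ r) (iteratedDeriv 2 ρ₀ r) (C (ρ₀ r)) C' s t c P' z) := by
  set P : ℝ → ℝ := fun h => ∏ d, eta β (a * h) (u d) / nu β (a * h) (u d) with hPdef
  have hP : HasDerivAt P P' 0 := by
    rw [hP']; exact (differentiableAt_prod_eta_div_nu hβ0 hβ1 a u).hasDerivAt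
  have hP0 : P 0 = 1 := by
    simp only [hPdef, mul_zero, eta_zero, nu_zero]
    exact prod_eq_one fun d _ => div_self (tritWeight_pos hβ0 hβ1 _).ne'
  have hlin : ∀ b : ℝ, HasDerivAt (fun h : ℝ => r + b * h) b 0 := fun b => by
    simpa using ((hasDerivAt_id (0 : ℝ)).const_mul b).const_add r
  have hρd : ∀ b : ℝ, HasDerivAt (fun h => ρ₀ (r + b * h)) (deriv ρ₀ r * b) 0 := fun b => by
    refine HasDerivAt.comp (h₂ := ρ₀) 0 ?_ (hlin b)
    simpa using (hρ.differentiable (by simp) r).hasDerivAt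
  have hq : ∀ b : ℝ, HasDerivAt (fun h => dslope ρ₀ r (r + b * h))
      (iteratedDeriv 2 ρ₀ r / 2 * b) 0 := fun b => by
    refine HasDerivAt.comp (h₂ := dslope ρ₀ r) 0 ?_ (hlin b)
    simpa using hasDerivAt_dslope_self (contDiff_infty.1 hρ 2) r
  have hρq : ∀ b h : ℝ, ρ₀ (r + b * h) = ρ₀ r + b * h * dslope ρ₀ r (r + b * h) := fun b h => by
    have := sub_smul_dslope ρ₀ r (r + b * h)
    simp only [smul_eq_mul, add_sub_cancel_left] at this
    linarith
  set Z : ℝ → ℝ := fun h => P h * ((ratioSlope a s h * ρ₀ (r + c * h)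
    + c * dslope ρ₀ r (r + c * h) - (ratioSlope a t h * ρ₀ (r + (c - t) * h)
    + (c - t) * dslope ρ₀ r (r + (c - t) * h))) / 2) with hZdef
  set Y : ℝ → ℝ := fun h => P h * (((1 + h * ratioSlope a s h) * ρ₀ (r + c * h)
    + (1 + h * ratioSlope a t h) * ρ₀ (r + (c - t) * h)) / 2) with hYdef
  have hZ0 : Z 0 = z := by
    simp only [hZdef, hP0, ratioSlope, mul_zero, add_zero, dslope_same, hz]
    ring
  have hY0 : Y 0 = ρ₀ r := by
    simp only [hYdef, hP0, mul_zero, zero_mul, add_zero]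
    ring
  have hR := fun x => hasDerivAt_ratioSlope a x
  have hR0 : ∀ x, ratioSlope a x 0 = x * a := fun x => by simp [ratioSlope]
  have hid := hasDerivAt_id (0 : ℝ)
  have hZ := hP.mul ((((hR s).mul (hρd c)).add ((hq c).const_mul c)).sub
    (((hR t).mul (hρd (c - t))).add ((hq (c - t)).const_mul (c - t))) |>.div_const 2)
  have hY := hP.mul (((((hid.mul (hR s)).const_add 1).mul (hρd c)).add
    (((hid.mul (hR t)).const_add 1).mul (hρd (c - t)))).div_const 2)
  have hXev : ∀ᶠ h in 𝓝 (0 : ℝ), ∀ x ∈ ({s, t} : Set ℝ), 1 - x * (a * h) / 2 ≠ 0 := by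
    have : ∀ x : ℝ, ∀ᶠ h in 𝓝 (0 : ℝ), 1 - x * (a * h) / 2 ≠ 0 := fun x => by
      have : ContinuousAt (fun h : ℝ => 1 - x * (a * h) / 2) 0 := by fun_prop
      exact this.eventually_ne (by simp)
    filter_upwards [this s, this t] with h h1 h2 x hx
    rcases hx with rfl | rfl <;> assumption
  have hexp := HasExpansion.comp_leading_term (F := fun p => ftilde f p.1 p.2)
    (X := fun h => h * Z h) hF (Eventually.of_forall fun h => rfl) hZ0 hY0 hZ hY hC
  have hcongr : (fun h => Floc β (a * h) r h ρ₀ f j ω u₀ u)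
      =ᶠ[𝓝 0] fun h => ftilde f (h * Z h) (Y h) := by
    filter_upwards [hXev] with h hh
    have h1 := eta_div_nu_eq hβ0 hβ1 (ω := ω) (by rw [← hs]; exact hh s (by simp))
    have h2 := eta_div_nu_eq hβ0 hβ1 (ω := u₀) (by rw [← ht]; exact hh t (by simp))
    have hct : ((j + 1 - ((u₀ : ℕ) : ℤ) : ℤ) : ℝ) + ∑ d, (1 - ((u d : ℕ) : ℝ)) = c - t := by
      rw [hc, ht, tritSign]; push_cast; ring
    simp only [Floc, rhoHat, ftilde, h1, h2, hct, ← hc, ← hs, ← ht]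
    congr 1
    · simp only [hZdef, hYdef]
      rw [hρq c h, hρq (c - t) h]
      ring
    · simp only [hZdef, hYdef]
      rw [hρq c h, hρq (c - t) h]
      ring
  obtain ⟨G, hG0, hG, hGo⟩ := hexp
  refine ⟨G, hG0, ?_, hGo.congr' ?_ EventuallyEq.rfl⟩
  · convert! hG using 1
    simp only [Pi.mul_apply, Pi.add_apply, Pi.sub_apply, hP0, hR0, id, mul_zero, add_zero, zero_mul,
      dslope_same, hz, flocSlope]
    ring
  · filter_upwards [hcongr] with h hh
    rw [hh]

theorem sum_choose_even_of_odd_mul_ite (A B β : ℝ) (n : ℕ) :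
    ∑ p ∈ range (n + 1), ((2 * n + 1).choose (2 * p) : ℝ) * A ^ (2 * p) * B ^ (2 * (n - p) + 1) *
        (if 2 * p = 0 then 1 else β)
      = β * (((A + B) ^ (2 * n + 1) - (A - B) ^ (2 * n + 1)) / 2) + (1 - β) * B ^ (2 * n + 1) := by
  rw [sum_mul_ite_zero_left, sum_choose_even_of_odd]
  simp

theorem sum_choose_odd_of_odd_mul_ite (A B β : ℝ) (n : ℕ) :
    ∑ p ∈ range (n + 1), ((2 * n + 1).choose (2 * p + 1) : ℝ) * A ^ (2 * p + 1) *
        B ^ (2 * (n - p)) * (if 2 * (n - p) = 0 then 1 else β)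
      = β * (((A + B) ^ (2 * n + 1) + (A - B) ^ (2 * n + 1)) / 2) + (1 - β) * A ^ (2 * n + 1) := by
  rw [sum_mul_ite_zero_right, sum_choose_odd_of_odd]
  simp

theorem sum_choose_even_of_even_mul_ite (A B β x y x' y' e : ℝ) (n : ℕ) :
    ∑ p ∈ range (n + 1), ((2 * n).choose (2 * p) : ℝ) * A ^ (2 * p) * B ^ (2 * (n - p)) *
        (x * (if 2 * (n - p) = 0 then 1 else β) + y * (if 2 * p = 0 then 1 else β)
          - e * (x' * (if 2 * (n - p) = 0 then 1 else β) + y' * (if 2 * p = 0 then 1 else β)))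
      = β * (((A + B) ^ (2 * n) + (A - B) ^ (2 * n)) / 2) * (x + y - e * (x' + y'))
        + (1 - β) * (A ^ (2 * n) * (x - e * x') + B ^ (2 * n) * (y - e * y')) := by
  have hl := sum_mul_ite_zero_left
    (fun p => ((2 * n).choose (2 * p) : ℝ) * A ^ (2 * p) * B ^ (2 * (n - p))) β n
  have hr := sum_mul_ite_zero_right
    (fun p => ((2 * n).choose (2 * p) : ℝ) * A ^ (2 * p) * B ^ (2 * (n - p))) β n
  rw [sum_choose_even_of_even] at hl hr
  simp only [mul_zero, pow_zero, Nat.choose_zero_right, Nat.cast_one, one_mul, mul_one,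
    Nat.sub_zero, Nat.sub_self, Nat.choose_self] at hl hr
  have hsplit : ∀ c S S' : ℕ → ℝ, ∑ p ∈ range (n + 1), c p * (x * S' p + y * S p
      - e * (x' * S' p + y' * S p)) = (x - e * x') * ∑ p ∈ range (n + 1), c p * S' p
        + (y - e * y') * ∑ p ∈ range (n + 1), c p * S p := fun c S S' => by
    rw [mul_sum, mul_sum, ← sum_add_distrib]
    exact sum_congr rfl fun p _ => by ring
  rw [hsplit (fun p => ((2 * n).choose (2 * p) : ℝ) * A ^ (2 * p) * B ^ (2 * (n - p)))
    (fun p => if 2 * p = 0 then 1 else β) (fun p => if 2 * (n - p) = 0 then 1 else β), hl, hr]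
  ring

theorem sum_prod_tritWeight (β : ℝ) (K : ℕ) :
    ∑ u : Fin K → Fin 3, ∏ d, tritWeight β (u d) = 1 := by
  rw [← Fintype.prod_sum (fun (_ : Fin K) ω => tritWeight β ω)]
  simp [sum_tritWeight]

theorem LII1_eq (D v β r : ℝ) (ρ₀ C : ℝ → ℝ) (ε δ : ℝ) (n : ℕ) {a ρ ρr ρrr A B : ℝ}
    (ha : a = v / D) (hρ : ρ = ρ₀ r) (hρr : ρr = deriv ρ₀ r) (hρrr : ρrr = iteratedDeriv 2 ρ₀ r)
    (hA : A = a * ρ) (hB : B = -a * ρ + ρr) :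
    LII1 D v β r ρ₀ C ε δ (2 * n + 1) n =
      -(1 - ε) * (v * C ρ / 2 ^ (2 * n + 1)) *
        ((δ + 1) * (β * (((A + B) ^ (2 * n + 1) - (A - B) ^ (2 * n + 1)) / 2)
            + (1 - β) * B ^ (2 * n + 1))
          + (δ - 1) * (β * (((A + B) ^ (2 * n + 1) + (A - B) ^ (2 * n + 1)) / 2)
            + (1 - β) * A ^ (2 * n + 1)))
      + (δ + 1) * (D / 2 ^ (2 * n + 1)) * deriv C ρ *
        ((a * ρ - ρr - ε * (a * ρ - ρr)) *
            (β * (((A + B) ^ (2 * n + 1) - (A - B) ^ (2 * n + 1)) / 2)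
              + (1 - β) * B ^ (2 * n + 1))
          + (a * ρ - ε * (a * ρ - 2 * ρr)) *
            (β * (((A + B) ^ (2 * n + 1) + (A - B) ^ (2 * n + 1)) / 2)
              + (1 - β) * A ^ (2 * n + 1)))
      + (δ + 1) * ((2 * n + 1 : ℝ) * D / 2 ^ (2 * n + 1)) * C ρ *
        ((β * (((A + B) ^ (2 * n) + (A - B) ^ (2 * n)) / 2) *
            (a ^ 2 * ρ + (-a ^ 2 * ρ + 2 * a * ρr - ρrr)
              - ε * ((a ^ 2 * ρ - 2 * a * ρr) + (-a ^ 2 * ρ + 2 * a * ρr - ρrr)))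
          + (1 - β) * (A ^ (2 * n) * (a ^ 2 * ρ - ε * (a ^ 2 * ρ - 2 * a * ρr))
            + B ^ (2 * n) * ((-a ^ 2 * ρ + 2 * a * ρr - ρrr)
              - ε * (-a ^ 2 * ρ + 2 * a * ρr - ρrr))))
          + β * ((((A + B) ^ (2 * n) - (A - B) ^ (2 * n)) / 2)
            * (0 - ε * (2 * a * ρr - 2 * ρrr)))) := by
  have hy : ∀ y : ℝ, ∑ p ∈ range (n + 1), ((2 * n + 1).choose (2 * p) : ℝ) * A ^ (2 * p) *
      B ^ (2 * (n - p) + 1) * y * (if 2 * p = 0 then 1 else β)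
      = y * (β * (((A + B) ^ (2 * n + 1) - (A - B) ^ (2 * n + 1)) / 2)
        + (1 - β) * B ^ (2 * n + 1)) := fun y => by
    rw [← sum_choose_even_of_odd_mul_ite A B β n, mul_sum]
    exact sum_congr rfl fun p _ => by ring
  have hy' : ∀ y : ℝ, ∑ p ∈ range (n + 1), ((2 * n + 1).choose (2 * p + 1) : ℝ) *
      A ^ (2 * p + 1) * B ^ (2 * (n - p)) * y * (if 2 * (n - p) = 0 then 1 else β)
      = y * (β * (((A + B) ^ (2 * n + 1) + (A - B) ^ (2 * n + 1)) / 2)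
        + (1 - β) * A ^ (2 * n + 1)) := fun y => by
    rw [← sum_choose_odd_of_odd_mul_ite A B β n, mul_sum]
    exact sum_congr rfl fun p _ => by ring
  unfold LII1
  simp only [← ha, ← hρ, ← hρr, ← hρrr, ← hA, ← hB, ← sum_mul]
  rw [sum_choose_even_of_odd_mul_ite, sum_choose_odd_of_odd_mul_ite, hy, hy',
    sum_choose_even_of_even_mul_ite, sum_choose_odd_of_even]
  push_cast
  ring

theorem odd_pow_half_trits (A B : ℝ) (n : ℕ) (ω t : Fin 3) :
    ((tritSign ω * A + tritSign t * B) / 2) ^ (2 * n + 1) =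
      (![![-(A + B) ^ (2 * n + 1), -A ^ (2 * n + 1), -(A - B) ^ (2 * n + 1)],
        ![-B ^ (2 * n + 1), 0, B ^ (2 * n + 1)],
        ![(A - B) ^ (2 * n + 1), A ^ (2 * n + 1), (A + B) ^ (2 * n + 1)]] ω t) /
        2 ^ (2 * n + 1) := by
  have ho : Odd (2 * n + 1) := odd_two_mul_add_one n
  rw [div_pow]
  congr 1
  fin_cases ω <;> fin_cases t <;> norm_num [tritSign, ← ho.neg_pow] <;> congr 1 <;> ring

theorem even_pow_half_trits (A B : ℝ) (n : ℕ) (ω t : Fin 3) :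
    ((tritSign ω * A + tritSign t * B) / 2) ^ (2 * n) =
      2 * (![![(A + B) ^ (2 * n), A ^ (2 * n), (A - B) ^ (2 * n)],
        ![B ^ (2 * n), 0 ^ (2 * n), B ^ (2 * n)],
        ![(A - B) ^ (2 * n), A ^ (2 * n), (A + B) ^ (2 * n)]] ω t) / 2 ^ (2 * n + 1) := by
  have he : Even (2 * n) := even_two_mul n
  rw [div_pow, pow_succ, mul_comm _ (2 : ℝ), mul_div_mul_left _ _ two_ne_zero]
  congr 1
  have hsub : (-A + B) ^ (2 * n) = (A - B) ^ (2 * n) := by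
    rw [← he.neg_pow, neg_add, neg_neg, ← sub_eq_add_neg]
  have hadd : (-A - B) ^ (2 * n) = (A + B) ^ (2 * n) := by
    rw [← neg_add', he.neg_pow]
  fin_cases ω <;> fin_cases t <;> norm_num [tritSign, he.neg_pow, hsub, hadd, ← sub_eq_add_neg]

theorem sum_expansion_coeff (D v β r : ℝ) (ρ₀ C : ℝ → ℝ) (ε δ : ℝ) (n : ℕ)
    (hD : D ≠ 0) (V V' N P' : ℝ) {a ρ A B : ℝ}
    (ha : a = v / D) (hρ : ρ = ρ₀ r) (hA : A = a * ρ) (hB : B = -a * ρ + deriv ρ₀ r) :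
    ∑ ω : Fin 3, ∑ t : Fin 3,
      (((1 - δ) * tritWeight β ω * (tritSign ω * a / 2) * (tritWeight β t * V)
          + (1 + δ) * tritWeight β ω *
            (-(tritWeight β t * (tritSign t * a / 2)) * V + tritWeight β t * V')) *
          (C ρ * ((tritSign ω * A + tritSign t * B) / 2) ^ (2 * n + 1)
            + -ε * (C ρ * ((tritSign ω * A + tritSign t * B) / 2) ^ (2 * n + 1)))
        + (1 + δ) * tritWeight β ω * (tritWeight β t * V) *
          (flocSlope (2 * n + 1) a ρ (deriv ρ₀ r) (iteratedDeriv 2 ρ₀ r) (C ρ) (deriv C ρ)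
              (tritSign ω) (tritSign t) N P' ((tritSign ω * A + tritSign t * B) / 2)
            + -ε * flocSlope (2 * n + 1) a ρ (deriv ρ₀ r) (iteratedDeriv 2 ρ₀ r) (C ρ) (deriv C ρ)
              (tritSign ω) (tritSign t) (-tritSign ω + N) P'
              ((tritSign ω * A + tritSign t * B) / 2)))
      = V * (β / (2 * D) * LII1 D v β r ρ₀ C ε δ (2 * n + 1) n) := by
  have hv : v = a * D := by rw [ha]; field_simp
  rw [LII1_eq D v β r ρ₀ C ε δ n ha hρ rfl rfl hA hB]
  simp only [flocSlope, Nat.add_sub_cancel, odd_pow_half_trits, even_pow_half_trits]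
  generalize (A + B) ^ (2 * n + 1) = p₁
  generalize (A - B) ^ (2 * n + 1) = p₂
  generalize A ^ (2 * n + 1) = p₃
  generalize B ^ (2 * n + 1) = p₄
  generalize (A + B) ^ (2 * n) = q₁
  generalize (A - B) ^ (2 * n) = q₂
  generalize A ^ (2 * n) = q₃
  generalize B ^ (2 * n) = q₄
  generalize (0 : ℝ) ^ (2 * n) = q₅
  have hT : (2 : ℝ) ^ (2 * n + 1) ≠ 0 := by positivity
  generalize (2 : ℝ) ^ (2 * n + 1) = T at hT
  have h0 : tritSign 0 = -1 := by norm_num [tritSign]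
  have h1 : tritSign 1 = 0 := by norm_num [tritSign]
  have h2 : tritSign 2 = 1 := by norm_num [tritSign]
  have w0 : tritWeight β 0 = β / 2 := by simp [tritWeight]
  have w1 : tritWeight β 1 = 1 - β := by simp [tritWeight]
  have w2 : tritWeight β 2 = β / 2 := by simp [tritWeight]
  simp only [Fin.sum_univ_three, h0, h1, h2, w0, w1, w2, Matrix.cons_val, hv]
  generalize deriv C ρ = C'
  generalize C ρ = c
  subst hA hB
  push_cast
  field_simp
  ring

theorem sum_leading_coeff (β δ ε c V : ℝ) (A B : ℝ) (n : ℕ) :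
    ∑ ω : Fin 3, ∑ t : Fin 3, (1 + δ) * tritWeight β ω * (tritWeight β t * V) *
      (c * ((tritSign ω * A + tritSign t * B) / 2) ^ (2 * n + 1)
        + -ε * (c * ((tritSign ω * A + tritSign t * B) / 2) ^ (2 * n + 1))) = 0 := by
  simp only [odd_pow_half_trits, Fin.sum_univ_three, Matrix.cons_val]
  simp only [tritWeight]
  norm_num
  ring

theorem hasDerivAt_weight (β a δ : ℝ) {K : ℕ} (ω t : Fin 3) (u : Fin K → Fin 3) {V' : ℝ}
    (hV' : HasDerivAt (fun h => ∏ d, nu β (a * h) (u d)) V' 0) :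
    HasDerivAt (fun h => (eta β (a * h) ω + δ * nu β (a * h) ω) *
        (nu β (a * h) t * ∏ d, nu β (a * h) (u d)))
      ((1 - δ) * tritWeight β ω * (tritSign ω * a / 2) *
          (tritWeight β t * ∏ d, tritWeight β (u d))
        + (1 + δ) * tritWeight β ω * (-(tritWeight β t * (tritSign t * a / 2)) *
          ∏ d, tritWeight β (u d) + tritWeight β t * V')) 0 := by
  convert! ((hasDerivAt_eta β a ω).add ((hasDerivAt_nu β a ω).const_mul δ)).mul
    ((hasDerivAt_nu β a t).mul hV') using 1
  simp only [Pi.add_apply, Pi.mul_apply, mul_zero, eta_zero, nu_zero]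
  ring

theorem contDiff_ftilde {f : ℝ → ℝ → ℝ} (hf : ContDiff ℝ (⊤ : ℕ∞) (Function.uncurry f)) :
    ContDiff ℝ (⊤ : ℕ∞) (fun p : ℝ × ℝ => ftilde f p.1 p.2) :=
  hf.comp ((contDiff_snd.add contDiff_fst).prodMk (contDiff_snd.sub contDiff_fst))

end

/-- Leading-order form, Case II-1: if m = 2m′+1 is odd (m′ ≥ 0) and (ε = −1 or δ = 1),
then lim_{Δr→0⁺} Δr^(1−m)·⟨A⟩(Δr) = L as given by `LII1`. -/
theorem leading_form_II1
    (D v β r : ℝ) (k : ℕ) (ρ₀ : ℝ → ℝ) (f : ℝ → ℝ → ℝ)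
    (ε δ : ℝ) (m : ℕ) (Chat : ℝ → ℝ)
    (hD : 0 < D) (hβ0 : 0 < β) (hβ1 : β < 1) (hk : 1 ≤ k)
    (hρ : ContDiff ℝ (⊤ : ℕ∞) ρ₀) (hρpos : ∀ x, 0 < ρ₀ x)
    (hf : ContDiff ℝ (⊤ : ℕ∞) (Function.uncurry f))
    (hε : ε = 1 ∨ ε = -1) (hδ : δ = 1 ∨ δ = -1)
    (hsym : ∀ x y, f y x = (-1 : ℝ) ^ m * f x y)
    (hlow : ∀ Y : ℝ, ∀ j < m, iteratedDeriv j (fun X => ftilde f X Y) 0 = 0)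
    (hchar : ∀ Y : ℝ, iteratedDeriv m (fun X => ftilde f X Y) 0 = (m.factorial : ℝ) * Chat Y)
    (hCbdd : ∃ M : ℝ, ∀ y, |Chat y| ≤ M) (hCne : ∀ y, Chat y ≠ 0)
    (m' : ℕ) (hm : m = 2 * m' + 1) (hcase : ε = -1 ∨ δ = 1) :
    Filter.Tendsto
      (fun Δr : ℝ => Δr ^ ((1 : ℤ) - (m : ℤ)) * avgA D v β r k ρ₀ f ε δ m Δr)
      (nhdsWithin 0 (Set.Ioi 0)) (nhds (LII1 D v β r ρ₀ Chat ε δ m m')) := by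
  have hmodd : Odd m := hm ▸ odd_two_mul_add_one m'
  have hF := contDiff_ftilde hf
  have hlead := isLittleO_sub_leading_term hF hmodd
    (fun x y => by
      simp only [ftilde]
      rw [sub_neg_eq_add, ← sub_eq_add_neg, hsym (y + x) (y - x), hmodd.neg_one_pow, neg_one_mul])
    hlow hchar (ρ₀ r)
  have hC : HasDerivAt Chat (deriv Chat (ρ₀ r)) (ρ₀ r) := by
    have hd : Differentiable ℝ fun y => iteratedDeriv m (fun X => ftilde f X y) 0 :=
      ((hF.iteratedDeriv_fst m).comp (contDiff_const.prodMk contDiff_id)).differentiable (by simp)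
    have he : Chat = fun y => iteratedDeriv m (fun X => ftilde f X y) 0 / (m.factorial : ℝ) := by
      funext y
      rw [hchar, mul_div_cancel_left₀ _ (by positivity)]
    rw [he]
    exact ((hd _).div_const _).hasDerivAt
  have hterm := fun (ω t : Fin 3) (u : Fin (k - 1) → Fin 3) =>
    ((hasExpansion_Floc (a := v / D) hβ0 hβ1 hρ hlead hC 0 ω t u rfl rfl rfl rfl rfl).add
      ((hasExpansion_Floc (a := v / D) hβ0 hβ1 hρ hlead hC (1 - ((ω : ℕ) : ℤ)) ω t u rfl rfl rfl
        rfl rfl).const_mul (ε * (-1) ^ m))).mul_left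
      (hasDerivAt_weight β (v / D) δ ω t u (differentiableAt_prod_nu β (v / D) u).hasDerivAt)
  have hsum := HasExpansion.sum fun ω (_ : ω ∈ univ) =>
    HasExpansion.sum fun t (_ : t ∈ univ) => HasExpansion.sum fun u (_ : u ∈ univ) => hterm ω t u
  have hcomm : ∀ g : Fin 3 → Fin 3 → (Fin (k - 1) → Fin 3) → ℝ,
      ∑ ω, ∑ t, ∑ u, g ω t u = ∑ u, ∑ ω, ∑ t, g ω t u := fun g =>
    (sum_congr rfl fun _ _ => sum_comm).trans sum_comm
  subst hm
  have hj : ∀ ω : Fin 3, ((1 - ((ω : ℕ) : ℤ) : ℤ) : ℝ) = -tritSign ω := fun ω => by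
    rw [tritSign]; push_cast; ring
  have hδw : ∀ x, x + δ * x = (1 + δ) * x := fun x => by ring
  have hε1 : ε * (-1) ^ (2 * m' + 1) = -ε := by rw [hmodd.neg_one_pow]; ring
  simp only [hcomm, mul_zero, eta_zero, nu_zero, hε1, hj, hδw, Int.cast_zero, zero_add] at hsum
  simp only [sum_leading_coeff, sum_const_zero,
    sum_expansion_coeff D v β r ρ₀ Chat ε δ m' hD.ne' _ _ _ _ rfl rfl rfl rfl, ← sum_mul,
    sum_prod_tritWeight, one_mul] at hsum
  have hlim := hsum.tendsto_div_pow.const_mul (2 * D / β)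
  have hL : 2 * D / β * (β / (2 * D) * LII1 D v β r ρ₀ Chat ε δ (2 * m' + 1) m')
      = LII1 D v β r ρ₀ Chat ε δ (2 * m' + 1) m' := by
    field_simp
  rw [hL] at hlim
  refine hlim.congr' ?_
  filter_upwards [self_mem_nhdsWithin] with h hh
  have hh0 : h ≠ 0 := ne_of_gt hh
  have hpow : h ^ ((1 : ℤ) - ((2 * m' + 1 : ℕ) : ℤ)) = h ^ 2 / h ^ (2 * m' + 1 + 1) := by
    rw [eq_div_iff (pow_ne_zero _ hh0), ← zpow_natCast, ← zpow_natCast, ← zpow_add₀ hh0]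
    congr 1
    push_cast
    ring
  simp only [avgA, Ksum, hpow, hcomm, hε1, show v * h / D = v / D * h by ring]
  field_simp
end
end
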